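/- Determinant formula: Let d ≥ 1 and let X be a d-dimensional combinatorial cell structure that is APC. Let T ⊆ X_d and S ⊆ X_{d−1} with |T| = |S| = |X_d| − β_d(X), let ∂_{S,T} be the square submatrix of ∂_d with rows S and columns T, and set S̄ = X_{d−1} ∖ S. If det ∂_{S,T} ≠ 0, then the groups H_{d−1}(X_T), H_{d−2}(X_{S̄}) and H_{d−2}(X) are all finite and |det ∂_{S,T}| · |H_{d−2}(X)| = |H_{d−1}(X_T)| · |H_{d−2}(X_{S̄})|. -/

import Mathlib

open BigOperators Matrix

/-- A `d`-dimensional combinatorial cell structure: nonempty finite sets of `i`-cells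
(of sizes `c i`, with `c i = 0` for `i > d`) together with integer boundary matrices
`D i` (the matrix of `∂_{i+1}`), satisfying `∂ ∘ ∂ = 0` and the condition that every
column of `∂_1 = D 0` sums to zero. -/
structure CellStructure (d : ℕ) where
  c : ℕ → ℕ
  c_pos : ∀ i, i ≤ d → 0 < c i
  c_zero : ∀ i, d < i → c i = 0
  D : (i : ℕ) → Matrix (Fin (c i)) (Fin (c (i + 1))) ℤ
  dd : ∀ i, D i * D (i + 1) = 0
  colsum : ∀ j, ∑ i, D 0 i j = 0

namespace CellStructure

variable {d : ℕ} (X : CellStructure d)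

/-- The augmentation map `ε : ℤ^{X_0} → ℤ`. -/
def aug : (Fin (X.c 0) → ℤ) →ₗ[ℤ] ℤ where
  toFun v := ∑ i, v i
  map_add' u v := by simp [Finset.sum_add_distrib]
  map_smul' r v := by simp [Finset.mul_sum]

/-- The rational augmentation map. -/
def augQ : (Fin (X.c 0) → ℚ) →ₗ[ℚ] ℚ where
  toFun v := ∑ i, v i
  map_add' u v := by simp [Finset.sum_add_distrib]
  map_smul' r v := by simp [Finset.mul_sum]

/-- `bdry i` is the boundary map `∂_{i+1} : C_{i+1} → C_i`. -/
def bdry (i : ℕ) : (Fin (X.c (i + 1)) → ℤ) →ₗ[ℤ] (Fin (X.c i) → ℤ) :=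
  Matrix.toLin' (X.D i)

/-- Reduced cycles: `Zker i = ker ∂_i` (with `∂_0 = ε` the augmentation). -/
def Zker : (i : ℕ) → Submodule ℤ (Fin (X.c i) → ℤ)
  | 0 => LinearMap.ker X.aug
  | (i + 1) => LinearMap.ker (X.bdry i)

/-- Rational reduced cycles: kernel of `∂_i ⊗ ℚ`. -/
def ZkerQ : (i : ℕ) → Submodule ℚ (Fin (X.c i) → ℚ)
  | 0 => LinearMap.ker X.augQ
  | (i + 1) => LinearMap.ker (Matrix.toLin' ((X.D i).map (Int.cast : ℤ → ℚ)))

/-- Reduced homology `H_i(X) = ker ∂_i / im ∂_{i+1}` for `i ≥ 0`. -/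
abbrev H (i : ℕ) : Type :=
  X.Zker i ⧸ (LinearMap.range (X.bdry i)).comap (X.Zker i).subtype

/-- `Hred j` is the reduced homology in dimension `j - 1`; in particular
`Hred 0 = H_{-1}(X) = ℤ / im ε`. -/
def Hred : ℕ → Type
  | 0 => ℤ ⧸ LinearMap.range X.aug
  | (i + 1) => X.H i

/-- `β_i(X)`, the rank of the `i`-th reduced homology group. -/
noncomputable def beta (i : ℕ) : ℕ := Module.finrank ℤ (X.H i)

/-- `X` is acyclic in positive codimension. -/
def APC : Prop := ∀ i, i < d → X.beta i = 0

/-- The span of the columns of `∂_{j+1}` indexed by `T`. -/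
def colSpan (j : ℕ) (T : Finset (Fin (X.c (j + 1)))) : Submodule ℤ (Fin (X.c j) → ℤ) :=
  Submodule.span ℤ ((fun t => (X.D j)ᵀ t) '' (T : Set (Fin (X.c (j + 1)))))

/-- For `T ⊆ X_{j+1}`, the homology group `H_j(X_T)` of the subcomplex `X_T`. -/
abbrev Hsub (j : ℕ) (T : Finset (Fin (X.c (j + 1)))) : Type :=
  X.Zker j ⧸ (X.colSpan j T).comap (X.Zker j).subtype

/-- `HsubG k T` is `H_{k-1}(X_T)` for `T ⊆ X_k`; for `k = 0` this is
`H_{-1}(X_T) = ℤ / (ℤ-span of the entries of ε on T)` (all of which equal `1`). -/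
def HsubG : (k : ℕ) → Finset (Fin (X.c k)) → Type
  | 0, T => ℤ ⧸ Submodule.span ℤ ((fun _v => (1 : ℤ)) '' (T : Set (Fin (X.c 0))))
  | (j + 1), T => X.Hsub j T

/-- `T ⊆ X_{j+1}` is a cellular spanning `(j+1)`-tree of `X`. -/
def IsTree (j : ℕ) (T : Finset (Fin (X.c (j + 1)))) : Prop :=
  LinearIndependent ℤ (fun t : {f // f ∈ T} => (X.D j)ᵀ (t : Fin (X.c (j + 1))))
    ∧ Nat.card (X.Hsub j T) ≠ 0
    ∧ T.card = Module.finrank ℚ (X.ZkerQ j)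

/-- `IsTreeG k T` : `T ⊆ X_k` is a cellular spanning `k`-tree of `X`; a spanning
`0`-tree is a single vertex. -/
def IsTreeG : (k : ℕ) → Finset (Fin (X.c k)) → Prop
  | 0, T => LinearIndependent ℤ (fun _t : {f // f ∈ T} => (1 : ℤ))
      ∧ Nat.card (ℤ ⧸ Submodule.span ℤ ((fun _v => (1 : ℤ)) '' (T : Set (Fin (X.c 0))))) ≠ 0
      ∧ T.card = 1
  | (j + 1), T => X.IsTree j T

open Classical in
/-- The torsion-weighted spanning tree enumerators `τ_k(X)`, with `τ_0(X) = |X_0|`. -/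
noncomputable def tau : ℕ → ℕ
  | 0 => X.c 0
  | (j + 1) => ∑ T : Finset (Fin (X.c (j + 1))),
      if X.IsTree j T then (Nat.card (X.Hsub j T)) ^ 2 else 0

/-- The real boundary matrix of `∂_{i+1}`. -/
noncomputable def Dr (i : ℕ) : Matrix (Fin (X.c i)) (Fin (X.c (i + 1))) ℝ :=
  (X.D i).map (Int.cast : ℤ → ℝ)

/-- The up-down Laplacian `L^ud_i = ∂_{i+1} ∂_{i+1}^T` as a real matrix. -/
noncomputable def Lud (i : ℕ) : Matrix (Fin (X.c i)) (Fin (X.c i)) ℝ :=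
  X.Dr i * (X.Dr i)ᴴ

theorem Lud_isHermitian (i : ℕ) : (X.Lud i).IsHermitian :=
  Matrix.isHermitian_mul_conjTranspose_self _

/-- `π_k(X)`: the product of the nonzero eigenvalues of `L^ud_{k-1}` for `k ≥ 1`,
and `π_0(X) = |X_0|`. -/
noncomputable def piNZ : ℕ → ℝ
  | 0 => (X.c 0 : ℝ)
  | (j + 1) => ∏ i, (if (X.Lud_isHermitian j).eigenvalues i = 0 then 1
      else (X.Lud_isHermitian j).eigenvalues i)

end CellStructure

theorem AddSubgroup.index_map_mul_relIndex_range {A B M : Type*} [AddCommGroup A]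
    [AddCommGroup B] [AddCommGroup M] (f : A →+ M) (p : A →+ B) (hp : Function.Surjective p)
    {K : AddSubgroup M} (hK : f.range ≤ K) {I : AddSubgroup A} (hI : I ≤ f.ker)
    (hfp : Disjoint f.ker p.ker) :
    (I.map p).index * f.range.relIndex K = I.relIndex f.ker * (p.ker.map f).relIndex K := by
  have h₁ : (I.map p).index = (I ⊔ p.ker).relIndex (f.ker ⊔ p.ker) * (f.ker ⊔ p.ker).index := by
    rw [relIndex_mul_index (sup_le_sup_right hI _), index_map, p.range_eq_top_of_surjective hp,
      index_top, mul_one]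
  have h₂ : (I ⊔ p.ker).relIndex (f.ker ⊔ p.ker) = I.relIndex f.ker := by
    have h : f.ker ⊔ (I ⊔ p.ker) = f.ker ⊔ p.ker := by
      rw [← sup_assoc, sup_eq_left.mpr hI]
    rw [← h, relIndex_sup_right, ← inf_relIndex_right, sup_inf_assoc_of_le _ hI,
      hfp.symm.eq_bot, sup_bot_eq]
  have h₃ : (p.ker.map f).relIndex f.range = (f.ker ⊔ p.ker).index := by
    rw [AddMonoidHom.range_eq_map, relIndex_map_map, top_sup_eq, relIndex_top_right, sup_comm]
  rw [h₁, h₂, mul_assoc, ← h₃,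
    relIndex_mul_relIndex _ _ _ (map_le_range f p.ker) hK]

theorem Matrix.index_span_range_col {m : ℕ} (A : Matrix (Fin m) (Fin m) ℤ) (hA : A.det ≠ 0) :
    (Submodule.span ℤ (Set.range A.col)).toAddSubgroup.index = A.det.natAbs := by
  have hli : LinearIndependent ℤ A.col := Matrix.linearIndependent_cols_of_det_ne_zero hA
  have h := Submodule.natAbs_det_basis_change (Pi.basisFun ℤ (Fin m)) _ (Module.Basis.span hli)
  have hv : ((↑) ∘ Module.Basis.span hli : Fin m → Fin m → ℤ) = A.col :=
    funext fun i => congrArg Subtype.val (Module.Basis.span_apply hli i)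
  rw [hv, Pi.basisFun_det_apply] at h
  have hdet : (Matrix.of A.col).det = A.det := A.det_transpose
  rw [← hdet]
  exact h.symm

theorem LinearMap.finrank_range_add_finrank_ker_int {M N : Type*} [AddCommGroup M]
    [AddCommGroup N] [Module.Finite ℤ M] (f : M →ₗ[ℤ] N) :
    Module.finrank ℤ (LinearMap.range f) + Module.finrank ℤ (LinearMap.ker f) =
      Module.finrank ℤ M := by
  rw [← f.quotKerEquivRange.finrank_eq, Submodule.finrank_quotient_add_finrank]

theorem LinearMap.ker_funLeft_subtype_eq_span {n m : ℕ} (S : Finset (Fin n))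
    (eS : Fin m ≃ {f // f ∈ S}) :
    LinearMap.ker (LinearMap.funLeft ℤ ℤ fun i => (eS i).1) =
      Submodule.span ℤ ((fun j => Pi.single j (1 : ℤ)) '' ((Sᶜ : Finset (Fin n)) : Set (Fin n))) := by
  apply le_antisymm
  · intro v hv
    have hS : ∀ j ∈ S, v j = 0 := fun j hj => by
      have := congrFun (LinearMap.mem_ker.mp hv) (eS.symm ⟨j, hj⟩)
      simpa [LinearMap.funLeft_apply] using this
    rw [pi_eq_sum_univ' v]
    refine Submodule.sum_mem _ fun j _ => ?_
    by_cases hj : j ∈ S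
    · simp [hS j hj]
    · refine Submodule.smul_mem _ _ (Submodule.subset_span ⟨j, by simpa using hj, ?_⟩)
      ext k
      simp [Pi.single_apply, eq_comm]
  · rw [Submodule.span_le]
    rintro _ ⟨j, hj, rfl⟩
    rw [SetLike.mem_coe, LinearMap.mem_ker]
    ext i
    have hne : (eS i).1 ≠ j := fun h => by
      have := (eS i).2
      simp_all
    simp [LinearMap.funLeft_apply, hne]

theorem LinearMap.natAbs_det_mul_relIndex_range {n m : ℕ} {M : Type*} [AddCommGroup M]
    (f : (Fin n → ℤ) →ₗ[ℤ] M) {K : Submodule ℤ M} (hK : LinearMap.range f ≤ K)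
    (S : Finset (Fin n)) (eS : Fin m ≃ {f // f ∈ S}) (v : Fin m → Fin n → ℤ)
    (hv : Submodule.span ℤ (Set.range v) ≤ LinearMap.ker f)
    (hf : Module.finrank ℤ (LinearMap.ker f) ≤ m)
    (hdet : (Matrix.of fun i j => v j (eS i).1).det ≠ 0) :
    (Matrix.of fun i j => v j (eS i).1).det.natAbs *
        (LinearMap.range f).toAddSubgroup.relIndex K.toAddSubgroup =
      (Submodule.span ℤ (Set.range v)).toAddSubgroup.relIndex (LinearMap.ker f).toAddSubgroup *
        (Submodule.span ℤ ((fun j => f (Pi.single j 1)) ''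
          ((Sᶜ : Finset (Fin n)) : Set (Fin n)))).toAddSubgroup.relIndex K.toAddSubgroup := by
  set A : Matrix (Fin m) (Fin m) ℤ := Matrix.of fun i j => v j (eS i).1 with hA
  let p : (Fin n → ℤ) →ₗ[ℤ] (Fin m → ℤ) := LinearMap.funLeft ℤ ℤ fun i => (eS i).1
  have hp : Function.Surjective p := LinearMap.funLeft_surjective_of_injective _ _ _
    (Subtype.val_injective.comp eS.injective)
  have hmap : (Submodule.span ℤ (Set.range v)).map p = Submodule.span ℤ (Set.range A.col) := by
    rw [Submodule.map_span, ← Set.range_comp]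
    rfl
  have hdisj : Disjoint (LinearMap.ker f) (LinearMap.ker p) := by
    have hle : m ≤ Module.finrank ℤ (LinearMap.range (p.domRestrict (LinearMap.ker f))) := by
      have hli : LinearIndependent ℤ A.col :=
        Matrix.linearIndependent_cols_of_det_ne_zero hdet
      have h := finrank_span_eq_card hli
      rw [Fintype.card_fin] at h
      rw [← hmap] at h
      rw [LinearMap.range_domRestrict]
      exact h.symm.trans_le <| Submodule.finrank_mono (Submodule.map_mono hv)
    have hrn := (p.domRestrict (LinearMap.ker f)).finrank_range_add_finrank_ker_int
    have hker : LinearMap.ker (p.domRestrict (LinearMap.ker f)) = ⊥ :=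
      Submodule.finrank_eq_zero.mp (by omega)
    rw [Submodule.disjoint_def]
    intro x hx hpx
    have : (⟨x, hx⟩ : LinearMap.ker f) ∈ LinearMap.ker (p.domRestrict (LinearMap.ker f)) := hpx
    rw [hker, Submodule.mem_bot] at this
    exact congrArg Subtype.val this
  have hdisj' : Disjoint f.toAddMonoidHom.ker p.toAddMonoidHom.ker := by
    rw [AddSubgroup.disjoint_def]
    exact fun {x} hx hpx => Submodule.disjoint_def.mp hdisj x hx hpx
  have key := AddSubgroup.index_map_mul_relIndex_range f.toAddMonoidHom p.toAddMonoidHom hp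
    (K := K.toAddSubgroup) hK (I := (Submodule.span ℤ (Set.range v)).toAddSubgroup) hv hdisj'
  have hspan : Submodule.span ℤ ((fun j => f (Pi.single j 1)) ''
      ((Sᶜ : Finset (Fin n)) : Set (Fin n))) = (LinearMap.ker p).map f := by
    rw [LinearMap.ker_funLeft_subtype_eq_span, Submodule.map_span, Set.image_image]
  rw [hspan, ← A.index_span_range_col hdet, ← hmap]
  exact key

namespace CellStructure

variable {d : ℕ} (X : CellStructure d)

theorem range_bdry_le_Zker (i : ℕ) : LinearMap.range (X.bdry i) ≤ X.Zker i := by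
  rintro _ ⟨v, rfl⟩
  cases i with
  | zero =>
    change ∑ i, (X.D 0).mulVec v i = 0
    simp only [Matrix.mulVec, dotProduct]
    rw [Finset.sum_comm]
    simp [← Finset.sum_mul, X.colsum]
  | succ i =>
    change Matrix.toLin' (X.D i) (Matrix.toLin' (X.D (i + 1)) v) = 0
    rw [← Matrix.toLin'_mul_apply, X.dd, map_zero, LinearMap.zero_apply]

theorem bdry_single (i : ℕ) (j : Fin (X.c (i + 1))) :
    X.bdry i (Pi.single j 1) = (X.D i)ᵀ j := by
  simp [bdry, Matrix.col_def]

theorem colSpan_le_range_bdry (i : ℕ) (T : Finset (Fin (X.c (i + 1)))) :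
    X.colSpan i T ≤ LinearMap.range (X.bdry i) := by
  rw [colSpan, Submodule.span_le]
  rintro _ ⟨j, -, rfl⟩
  exact ⟨Pi.single j 1, X.bdry_single i j⟩

theorem finrank_ker_bdry_of_eq (i : ℕ) (hi : X.c (i + 2) = 0) :
    Module.finrank ℤ (LinearMap.ker (X.bdry i)) = X.beta (i + 1) := by
  have : IsEmpty (Fin (X.c (i + 2))) := by rw [hi]; infer_instance
  have hrange : LinearMap.range (X.bdry (i + 1)) = ⊥ := by
    rw [LinearMap.range_eq_bot]
    exact Subsingleton.elim _ _
  have h := Submodule.finrank_quotient_add_finrank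
    ((LinearMap.range (X.bdry (i + 1))).comap (X.Zker (i + 1)).subtype)
  have hcomap : (LinearMap.range (X.bdry (i + 1))).comap (X.Zker (i + 1)).subtype = ⊥ := by
    rw [hrange]
    exact (X.Zker (i + 1)).ker_subtype
  have hzero : Module.finrank ℤ
      ((LinearMap.range (X.bdry (i + 1))).comap (X.Zker (i + 1)).subtype) = 0 := by
    rw [hcomap, finrank_bot]
  rw [hzero, add_zero] at h
  exact h.symm

theorem finrank_Zker_of_beta_eq_zero (i : ℕ) (hi : X.beta i = 0) :
    Module.finrank ℤ (X.Zker i) = Module.finrank ℤ (LinearMap.range (X.bdry i)) := by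
  have h := Submodule.finrank_quotient_add_finrank
    ((LinearMap.range (X.bdry i)).comap (X.Zker i).subtype)
  have h₀ : Module.finrank ℤ (X.H i) = 0 := hi
  rw [h₀, zero_add] at h
  rw [← h]
  exact (Submodule.comapSubtypeEquivOfLe (X.range_bdry_le_Zker i)).finrank_eq

theorem finite_H_of_beta_eq_zero (i : ℕ) (hi : X.beta i = 0) : Finite (X.H i) :=
  Submodule.finiteQuotient_iff _ |>.mpr <| by
    rw [X.finrank_Zker_of_beta_eq_zero i hi]
    exact (Submodule.comapSubtypeEquivOfLe (X.range_bdry_le_Zker i)).finrank_eq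

theorem finrank_Zker_of_APC {e : ℕ} (X : CellStructure (e + 1)) (hAPC : X.APC) :
    Module.finrank ℤ (X.Zker e) = X.c (e + 1) - X.beta (e + 1) := by
  have hrn := (X.bdry e).finrank_range_add_finrank_ker_int
  rw [X.finrank_ker_bdry_of_eq e (X.c_zero _ (by omega)), Module.finrank_pi,
    Fintype.card_fin] at hrn
  rw [X.finrank_Zker_of_beta_eq_zero e (hAPC e (by omega))]
  omega

theorem aug_range (hc : 0 < X.c 0) : LinearMap.range X.aug = ⊤ := by
  rw [LinearMap.range_eq_top]
  exact fun z => ⟨Pi.single ⟨0, hc⟩ z, by simp [aug]⟩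

theorem span_range_eq_colSpan (i : ℕ) {m : ℕ} (T : Finset (Fin (X.c (i + 1))))
    (eT : Fin m ≃ {f // f ∈ T}) :
    Submodule.span ℤ (Set.range fun j => (X.D i)ᵀ (eT j).1) = X.colSpan i T := by
  have h : Set.range (fun j => (X.D i)ᵀ (eT j).1) = (fun t => (X.D i)ᵀ t) '' (T : Set _) := by
    ext w
    constructor
    · rintro ⟨j, rfl⟩
      exact ⟨_, (eT j).2, rfl⟩
    · rintro ⟨t, ht, rfl⟩
      exact ⟨eT.symm ⟨t, ht⟩, by simp⟩
  rw [h, colSpan]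

theorem natAbs_det_mul_card_Hred {e : ℕ} (X : CellStructure (e + 1)) {m : ℕ}
    (T : Finset (Fin (X.c (e + 1)))) (S : Finset (Fin (X.c e)))
    (hrank : Module.finrank ℤ (X.Zker e) ≤ m)
    (eS : Fin m ≃ {f // f ∈ S}) (eT : Fin m ≃ {f // f ∈ T})
    (hdet : Matrix.det (Matrix.of fun i j => X.D e (eS i).1 (eT j).1) ≠ 0) :
    (Matrix.det (Matrix.of fun i j => X.D e (eS i).1 (eT j).1)).natAbs * Nat.card (X.Hred e) =
      Nat.card (X.Hsub e T) * Nat.card (X.HsubG e Sᶜ) := by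
  have hspan := X.span_range_eq_colSpan e T eT
  have hle := (X.colSpan_le_range_bdry e T).trans (X.range_bdry_le_Zker e)
  rw [← hspan] at hle
  cases e with
  | zero =>
    have key := LinearMap.natAbs_det_mul_relIndex_range X.aug (K := ⊤) le_top S eS
      (fun j => (X.D 0)ᵀ (eT j).1) hle hrank hdet
    have haug : (fun j => X.aug (Pi.single j 1)) = fun _ => (1 : ℤ) := by
      ext j
      simp [aug]
    rw [hspan, haug, Submodule.top_toAddSubgroup, AddSubgroup.relIndex_top_right,
      AddSubgroup.relIndex_top_right] at key
    exact key
  | succ k =>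
    have key := LinearMap.natAbs_det_mul_relIndex_range (X.bdry k) (X.range_bdry_le_Zker k) S eS
      (fun j => (X.D (k + 1))ᵀ (eT j).1) hle hrank hdet
    rw [hspan, funext (X.bdry_single k)] at key
    exact key

theorem card_Hred_ne_zero {e : ℕ} (X : CellStructure (e + 1)) (hAPC : X.APC) :
    Nat.card (X.Hred e) ≠ 0 := by
  cases e with
  | zero =>
    change Nat.card (ℤ ⧸ LinearMap.range X.aug) ≠ 0
    rw [X.aug_range (X.c_pos 0 (by omega)), Nat.card_unique]
    exact one_ne_zero
  | succ k =>
    have := X.finite_H_of_beta_eq_zero k (hAPC k (by omega))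
    exact (Nat.card_pos (α := X.H k)).ne'

end CellStructure

/-- **Determinant formula** (Duval–Klivans–Martin, Prop. 2.8).
Let `d = e + 1 ≥ 1`, let `X` be a `d`-dimensional APC combinatorial cell structure, and
let `T ⊆ X_d`, `S ⊆ X_{d-1}` with `|T| = |S| = |X_d| - β_d(X)`; let `∂_{S,T}` be the
square submatrix of `∂_d` with rows `S` and columns `T` (via any indexings by `Fin m`).
If `det ∂_{S,T} ≠ 0`, then `H_{d-1}(X_T)`, `H_{d-2}(X_{S̄})` and `H_{d-2}(X)` are all
finite and `|det ∂_{S,T}| · |H_{d-2}(X)| = |H_{d-1}(X_T)| · |H_{d-2}(X_{S̄})|`, where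
`S̄ = X_{d-1} ∖ S`. -/
theorem determinant_formula
    (e : ℕ) (X : CellStructure (e + 1)) (hAPC : X.APC)
    (T : Finset (Fin (X.c (e + 1)))) (S : Finset (Fin (X.c e)))
    (hT : T.card = X.c (e + 1) - X.beta (e + 1)) (hS : S.card = T.card)
    (m : ℕ) (eS : Fin m ≃ {f // f ∈ S}) (eT : Fin m ≃ {f // f ∈ T})
    (hdet : Matrix.det (Matrix.of fun i j => X.D e (eS i).1 (eT j).1) ≠ 0) :
    Nat.card (X.Hsub e T) ≠ 0 ∧ Nat.card (X.HsubG e Sᶜ) ≠ 0 ∧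
      Nat.card (X.Hred e) ≠ 0 ∧
      (Matrix.det (Matrix.of fun i j => X.D e (eS i).1 (eT j).1)).natAbs *
          Nat.card (X.Hred e) =
        Nat.card (X.Hsub e T) * Nat.card (X.HsubG e Sᶜ) := by
  have hm : m = T.card := by
    simpa using Fintype.card_congr eT
  have hrank : Module.finrank ℤ (X.Zker e) ≤ m := by
    rw [X.finrank_Zker_of_APC hAPC, hm, hT]
  have hH := X.card_Hred_ne_zero hAPC
  have key := X.natAbs_det_mul_card_Hred T S hrank eS eT hdet
  have hne := mul_ne_zero (Int.natAbs_ne_zero.mpr hdet) hH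
  rw [key, mul_ne_zero_iff] at hne
  exact ⟨hne.1, hne.2, hH, key⟩
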